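/- arXiv:1505.04343 — 2 statements merged into one kernel-verified Lean document; each statement's English description precedes it below -/
import Mathlib

section
/- Let n ≥ k ≥ 1 and let λ_1 ≥ λ_2 ≥ ⋯ ≥ λ_n ≥ 0 be a nonincreasing sequence of nonnegative reals. Then Π_{t=1}^{k} ( Σ_{i=t}^{n} λ_i ) ≤ k! · Σ_{1 ≤ i_1 < i_2 < ⋯ < i_k ≤ n} λ_{i_1} λ_{i_2} ⋯ λ_{i_k}. In particular, for a matrix with squared singular values λ_1 ≥ ⋯ ≥ λ_n, the product ‖M‖_F² ‖M−M_1‖_F² ⋯ ‖M−M_{k−1}‖_F² is at most k! times the k-th elementary symmetric polynomial of the squared singular values. -/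
open Finset

lemma aux_tail {n k : ℕ} (hk : k < n) (lam : Fin n → ℝ) (hmono : Antitone lam)
    (S : Finset (Fin n)) (hS : S.card = k) :
    ∑ i ∈ Finset.univ.filter (fun i : Fin n => k ≤ (i : ℕ)), lam i ≤ ∑ i ∈ Sᶜ, lam i := by
  set c := lam ⟨k, hk⟩ with hc
  have hcard : (Finset.univ.filter (fun i : Fin n => k ≤ (i : ℕ))).card = Sᶜ.card := by
    have h : (Finset.univ.filter (fun i : Fin n => k ≤ (i : ℕ))) = Finset.Ici ⟨k, hk⟩ := by
      ext i; simp [Fin.le_def]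
    rw [h, Fin.card_Ici, Finset.card_compl, hS, Fintype.card_fin]
  have h1 : ∑ i ∈ Finset.univ.filter (fun i : Fin n => k ≤ (i : ℕ)), (lam i - c)
      ≤ ∑ i ∈ Sᶜ, (lam i - c) := by
    have e : Sᶜ = Finset.univ.filter (fun i : Fin n => i ∉ S) := by ext i; simp
    rw [e, Finset.sum_filter, Finset.sum_filter]
    apply Finset.sum_le_sum
    intro i _
    by_cases h : k ≤ (i : ℕ)
    · have : lam i ≤ c := hmono (by simpa [Fin.le_def] using h)
      split_ifs <;> linarith
    · have : c ≤ lam i := hmono (by simp only [Fin.le_def]; omega)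
      split_ifs <;> linarith
  simp only [Finset.sum_sub_distrib, Finset.sum_const, hcard] at h1
  linarith

lemma aux_esymm {n : ℕ} (k : ℕ) (lam : Fin n → ℝ) :
    ((k : ℝ) + 1) * ∑ S ∈ (Finset.univ : Finset (Fin n)).powersetCard (k + 1), ∏ i ∈ S, lam i
      = ∑ S ∈ (Finset.univ : Finset (Fin n)).powersetCard k,
          (∏ i ∈ S, lam i) * ∑ i ∈ Sᶜ, lam i := by
  have h1 : ((k : ℝ) + 1) *
      ∑ S ∈ (Finset.univ : Finset (Fin n)).powersetCard (k + 1), ∏ i ∈ S, lam i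
      = ∑ S ∈ (Finset.univ : Finset (Fin n)).powersetCard (k + 1),
          ∑ _i ∈ S, ∏ i ∈ S, lam i := by
    rw [Finset.mul_sum]
    apply Finset.sum_congr rfl
    intro S hS
    rw [Finset.sum_const, (Finset.mem_powersetCard.1 hS).2]
    simp
  rw [h1]
  simp only [Finset.mul_sum]
  rw [Finset.sum_sigma', Finset.sum_sigma']
  refine Finset.sum_bij' (fun p _ => ⟨p.1.erase p.2, p.2⟩) (fun p _ => ⟨insert p.2 p.1, p.2⟩)
    ?_ ?_ ?_ ?_ ?_
  · rintro ⟨S, i⟩ h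
    simp only [Finset.mem_sigma, Finset.mem_powersetCard] at h
    simp [Finset.card_erase_of_mem h.2, h.1.2]
  · rintro ⟨S, i⟩ h
    simp only [Finset.mem_sigma, Finset.mem_powersetCard, Finset.mem_compl] at h
    simp [Finset.card_insert_of_notMem h.2, h.1.2]
  · rintro ⟨S, i⟩ h
    simp only [Finset.mem_sigma] at h
    simp [Finset.insert_erase h.2]
  · rintro ⟨S, i⟩ h
    simp only [Finset.mem_sigma, Finset.mem_compl] at h
    simp [Finset.erase_insert h.2]
  · rintro ⟨S, i⟩ h
    simp only [Finset.mem_sigma] at h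
    exact (Finset.prod_erase_mul S lam h.2).symm

lemma aux_main {n : ℕ} (lam : Fin n → ℝ) (hnonneg : ∀ i, 0 ≤ lam i) (hmono : Antitone lam)
    (k : ℕ) (hkn : k ≤ n) :
    ∏ t : Fin k, (∑ i ∈ Finset.univ.filter (fun i : Fin n => (t : ℕ) ≤ (i : ℕ)), lam i) ≤
      (Nat.factorial k : ℝ) *
        ∑ S ∈ (Finset.univ : Finset (Fin n)).powersetCard k, ∏ i ∈ S, lam i := by
  induction k with
  | zero => simp
  | succ k ih =>
    rw [Fin.prod_univ_castSucc]
    simp only [Fin.val_castSucc, Fin.val_last]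
    have ih' := ih (by omega)
    have hT : 0 ≤ ∑ i ∈ Finset.univ.filter (fun i : Fin n => k ≤ (i : ℕ)), lam i :=
      Finset.sum_nonneg fun i _ => hnonneg i
    refine (mul_le_mul_of_nonneg_right ih' hT).trans ?_
    rw [Nat.factorial_succ, Nat.cast_mul, mul_comm ((k + 1 : ℕ) : ℝ), mul_assoc, mul_assoc]
    apply mul_le_mul_of_nonneg_left _ (Nat.cast_nonneg _)
    push_cast
    rw [aux_esymm, Finset.sum_mul]
    apply Finset.sum_le_sum
    intro S hS
    exact mul_le_mul_of_nonneg_left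
      (aux_tail (by omega) lam hmono S (Finset.mem_powersetCard.1 hS).2)
      (Finset.prod_nonneg fun i _ => hnonneg i)

/-- for a nonincreasing nonnegative sequence `λ_1 ≥ ⋯ ≥ λ_n ≥ 0`,
the product of the tail sums `∏_{t=1}^k Σ_{i=t}^n λ_i` is at most `k!` times the
`k`-th elementary symmetric polynomial of the sequence. -/
theorem prod_tail_sums_le_factorial_mul_esymm
    (n k : ℕ) (hk : 1 ≤ k) (hkn : k ≤ n)
    (lam : Fin n → ℝ) (hnonneg : ∀ i, 0 ≤ lam i) (hmono : Antitone lam) :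
    ∏ t : Fin k, (∑ i ∈ Finset.univ.filter (fun i : Fin n => (t : ℕ) ≤ (i : ℕ)), lam i) ≤
      (Nat.factorial k : ℝ) *
        ∑ S ∈ (Finset.univ : Finset (Fin n)).powersetCard k, ∏ i ∈ S, lam i := by
  exact aux_main lam hnonneg hmono k hkn
end

section
/- Fix δ ∈ (0,1) and 0 < m ≤ n. Let x ∈ ℝ^n be a nonzero vector with μ(x) ≤ μ0, and let Ω ⊆ {1,…,n} be a random subset in which each index is included independently with probability m/n. Define the norm estimate ĉ = (n/m) Σ_{i∈Ω} x_i². Then with probability at least 1 − 2δ, (1 − α)‖x‖₂² ≤ ĉ ≤ (1 + α)‖x‖₂², where α = √(2 μ0 log(1/δ)/m) + (2 μ0/(3m)) log(1/δ). -/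
open Finset

noncomputable section

/-- Incoherence of a vector: `n ‖x‖_∞² / ‖x‖₂²`. -/
def muVec {n : ℕ} (x : EuclideanSpace ℝ (Fin n)) : ℝ :=
  (n : ℝ) * (⨆ i, |x i|)^2 / ‖x‖^2

lemma bne_exp_aux1 {u : ℝ} (hu : 0 ≤ u) : 0 ≤ u + 2 + (u - 2) * Real.exp u := by
  have hd : ∀ x : ℝ, HasDerivAt (fun u : ℝ => u + 2 + (u - 2) * Real.exp u)
      (1 + (1 * Real.exp x + (x - 2) * Real.exp x)) x := fun x =>
    ((hasDerivAt_id x).add_const 2).add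
      (((hasDerivAt_id x).sub_const 2).mul (Real.hasDerivAt_exp x))
  have hm : Monotone (fun u : ℝ => u + 2 + (u - 2) * Real.exp u) := by
    apply monotone_of_deriv_nonneg (fun x => (hd x).differentiableAt)
    intro x
    rw [(hd x).deriv]
    have h1 := Real.add_one_le_exp (-x)
    have h2 := Real.exp_pos x
    have h3 : Real.exp (-x) * Real.exp x = 1 := by rw [← Real.exp_add]; simp
    nlinarith
  have := hm hu
  simp at this
  linarith

lemma bne_exp_aux2 {u : ℝ} (hu : 0 ≤ u) :
    (3 - u) * (Real.exp u - 1 - u) ≤ 3 * u ^ 2 / 2 := by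
  have hd : ∀ x : ℝ, HasDerivAt
      (fun u : ℝ => 3 * u ^ 2 / 2 - (3 - u) * (Real.exp u - 1 - u))
      (x + 2 + (x - 2) * Real.exp x) x := fun x => by
    have := ((((hasDerivAt_id x).pow 2).const_mul 3).div_const 2).sub
      (((hasDerivAt_id x).const_sub 3).mul
        (((Real.hasDerivAt_exp x).sub_const 1).sub (hasDerivAt_id x)))
    refine this.congr_deriv ?_
    simp
    ring
  have hm : MonotoneOn (fun u : ℝ => 3 * u ^ 2 / 2 - (3 - u) * (Real.exp u - 1 - u))
      (Set.Ici 0) := by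
    apply monotoneOn_of_deriv_nonneg (convex_Ici 0)
    · exact fun x _ => (hd x).continuousAt.continuousWithinAt
    · exact fun x _ => (hd x).differentiableAt.differentiableWithinAt
    · intro x hx
      rw [interior_Ici] at hx
      rw [(hd x).deriv]
      exact bne_exp_aux1 (le_of_lt hx)
  have := hm (Set.mem_Ici.2 le_rfl) (Set.mem_Ici.2 hu) hu
  simp at this
  linarith

lemma bne_exp_neg {u : ℝ} (hu : 0 ≤ u) : Real.exp (-u) - 1 ≤ -u + u ^ 2 / 2 := by
  have hd : ∀ x : ℝ, HasDerivAt
      (fun u : ℝ => -u + u ^ 2 / 2 - Real.exp (-u)) (-1 + x + Real.exp (-x)) x := fun x => by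
    have := ((hasDerivAt_id x).neg.add (((hasDerivAt_id x).pow 2).div_const 2)).sub
      ((hasDerivAt_id x).neg.exp)
    refine this.congr_deriv ?_
    simp
  have hm : Monotone (fun u : ℝ => -u + u ^ 2 / 2 - Real.exp (-u)) := by
    apply monotone_of_deriv_nonneg (fun x => (hd x).differentiableAt)
    intro x
    rw [(hd x).deriv]
    have h1 := Real.add_one_le_exp (-x)
    show (0 : ℝ) ≤ _
    linarith
  have := hm hu
  simp at this
  linarith

lemma bne_total {n : ℕ} (p : ℝ) (c : Fin n → ℝ) :
    ∑ ω : Fin n → Bool, (∏ i, (if ω i then p else 1 - p)) *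
      Real.exp (∑ i ∈ Finset.univ.filter (fun i => ω i = true), c i)
      = ∏ i, (p * Real.exp (c i) + (1 - p)) := by
  have h := Finset.prod_univ_sum (fun _ : Fin n => (Finset.univ : Finset Bool))
    (fun i b => (if b then p * Real.exp (c i) else 1 - p))
  rw [Fintype.piFinset_univ] at h
  simp only [Fintype.sum_bool] at h
  simp only [if_true, Bool.false_eq_true, if_false] at h
  rw [h]
  refine Finset.sum_congr rfl fun ω _ => ?_
  rw [Real.exp_sum, Finset.prod_filter, ← Finset.prod_mul_distrib]
  refine Finset.prod_congr rfl fun i _ => ?_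
  split_ifs <;> simp

lemma bne_chernoff {n : ℕ} (p : ℝ) (hp0 : 0 ≤ p) (hp1 : p ≤ 1) (c : Fin n → ℝ) (t L : ℝ)
    (P : (Fin n → Bool) → Prop) [DecidablePred P]
    (hP : ∀ ω, P ω → t ≤ ∑ i ∈ Finset.univ.filter (fun i => ω i = true), c i)
    (hL : L + ∑ i, p * (Real.exp (c i) - 1) ≤ t) :
    ∑ ω ∈ Finset.univ.filter P, (∏ i, (if ω i then p else 1 - p)) ≤ Real.exp (-L) := by
  have hw : ∀ ω : Fin n → Bool, 0 ≤ ∏ i, (if ω i then p else 1 - p) := fun ω =>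
    Finset.prod_nonneg fun i _ => by split_ifs <;> linarith
  calc _ ≤ ∑ ω : Fin n → Bool, (∏ i, (if ω i then p else 1 - p)) *
      Real.exp (∑ i ∈ Finset.univ.filter (fun i => ω i = true), c i) * Real.exp (-t) := by
        rw [Finset.sum_filter]
        refine Finset.sum_le_sum fun ω _ => ?_
        split_ifs with h
        · rw [mul_assoc, ← Real.exp_add]
          refine le_mul_of_one_le_right (hw ω) (Real.one_le_exp ?_)
          linarith [hP ω h]
        · exact mul_nonneg (mul_nonneg (hw ω) (Real.exp_pos _).le) (Real.exp_pos _).le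
    _ = (∏ i, (p * Real.exp (c i) + (1 - p))) * Real.exp (-t) := by
        rw [← Finset.sum_mul, bne_total]
    _ ≤ (∏ i, Real.exp (p * (Real.exp (c i) - 1))) * Real.exp (-t) := by
        refine mul_le_mul_of_nonneg_right ?_ (Real.exp_pos _).le
        refine Finset.prod_le_prod (fun i _ => ?_) (fun i _ => ?_)
        · have := mul_nonneg hp0 (Real.exp_pos (c i)).le
          linarith
        · have := Real.add_one_le_exp (p * (Real.exp (c i) - 1))
          linarith
    _ ≤ Real.exp (-L) := by
        rw [← Real.exp_sum, ← Real.exp_add]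
        exact Real.exp_le_exp.2 (by linarith)

lemma bne_core {n : ℕ} (p : ℝ) (hp0 : 0 < p) (hp1 : p ≤ 1) (y : Fin n → ℝ)
    (hy0 : ∀ i, 0 ≤ y i) (hy1 : ∑ i, y i = 1) (κ L : ℝ) (hκ : 0 < κ) (hL : 0 < L)
    (hyκ : ∀ i, y i / p ≤ κ) (α : ℝ) (hα : α = Real.sqrt (2 * κ * L) + 2 * κ * L / 3)
    (P : (Fin n → Bool) → Prop) [DecidablePred P]
    (hP : ∀ ω, ¬ P ω →
      (1 + α ≤ ∑ i ∈ Finset.univ.filter (fun i => ω i = true), y i / p) ∨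
      (∑ i ∈ Finset.univ.filter (fun i => ω i = true), y i / p ≤ 1 - α)) :
    1 - 2 * Real.exp (-L) ≤
      ∑ ω ∈ Finset.univ.filter P, (∏ i, (if ω i then p else 1 - p)) := by
  classical
  have hw : ∀ ω : Fin n → Bool, 0 ≤ ∏ i, (if ω i then p else 1 - p) := fun ω =>
    Finset.prod_nonneg fun i _ => by split_ifs <;> linarith
  obtain ⟨r, hr0, hr1, hr2⟩ : ∃ r : ℝ, 0 < r ∧ r * Real.sqrt (2 * κ * L) = 2 * L ∧
      r ^ 2 * κ = 2 * L := by
    have hs : 0 < Real.sqrt (2 * κ * L) := Real.sqrt_pos.2 (by positivity)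
    have hs2 : Real.sqrt (2 * κ * L) ^ 2 = 2 * κ * L := Real.sq_sqrt (by positivity)
    refine ⟨Real.sqrt (2 * κ * L) / κ, by positivity, ?_, ?_⟩
    · field_simp
      linarith
    · field_simp
      linarith
  have htot : ∑ ω : Fin n → Bool, (∏ i, (if ω i then p else 1 - p)) = 1 := by
    have := bne_total p (fun _ : Fin n => 0)
    simpa using this
  have hrα : r * α = 2 * L + r * κ * (2 * L / 3) := by
    rw [hα, mul_add, hr1]; ring
  have hup : ∑ ω ∈ Finset.univ.filter (fun ω : Fin n → Bool =>
      1 + α ≤ ∑ i ∈ Finset.univ.filter (fun i => ω i = true), y i / p),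
      (∏ i, (if ω i then p else 1 - p)) ≤ Real.exp (-L) := by
    have hq : 0 < 1 + r * κ / 3 := by positivity
    set l := r / (1 + r * κ / 3) with hl
    have hl0 : 0 < l := by positivity
    have hlq : l * (1 + r * κ / 3) = r := by rw [hl]; field_simp
    have hlk : (1 - l * κ / 3) * (1 + r * κ / 3) = 1 := by
      have : l * κ / 3 * (1 + r * κ / 3) = r * κ / 3 := by
        rw [← hlq]; ring_nf
        rw [hl]; field_simp; ring
      linarith
    have hlk0 : 0 < 1 - l * κ / 3 := by
      by_contra h
      push Not at h
      nlinarith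
    refine bne_chernoff p hp0.le hp1 (fun i => l * (y i / p)) (l * (1 + α)) L _ ?_ ?_
    · intro ω h
      rw [← Finset.mul_sum]
      exact mul_le_mul_of_nonneg_left h hl0.le
    · have hi : ∀ i, p * (Real.exp (l * (y i / p)) - 1) ≤
          (l + l ^ 2 * κ / 2 * (1 + r * κ / 3)) * y i := by
        intro i
        have hc0 : 0 ≤ y i / p := div_nonneg (hy0 i) hp0.le
        have hc1 := hyκ i
        have hpy : p * (y i / p) = y i := by field_simp
        generalize y i / p = c at *
        have hu : 0 ≤ l * c := by positivity
        have h1 := bne_exp_aux2 hu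
        have h2 : 0 ≤ Real.exp (l * c) - 1 - l * c := by
          linarith [Real.add_one_le_exp (l * c)]
        have h3 : (1 - l * κ / 3) * (Real.exp (l * c) - 1 - l * c) ≤ (l * c) ^ 2 / 2 := by
          have : (1 - l * κ / 3) ≤ (3 - l * c) / 3 := by
            have := mul_le_mul_of_nonneg_left hc1 hl0.le
            linarith
          have := mul_le_mul_of_nonneg_right this h2
          linarith
        have h4 := mul_le_mul_of_nonneg_left h3 hq.le
        have h5 : Real.exp (l * c) - 1 - l * c ≤ (1 + r * κ / 3) * ((l * c) ^ 2 / 2) := by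
          calc _ = ((1 - l * κ / 3) * (1 + r * κ / 3)) * (Real.exp (l * c) - 1 - l * c) := by
                rw [hlk, one_mul]
            _ ≤ _ := by linarith
        have h6 : c ^ 2 ≤ c * κ := by nlinarith
        have h7 : (1 + r * κ / 3) * ((l * c) ^ 2 / 2) ≤
            (1 + r * κ / 3) * (l ^ 2 / 2) * (c * κ) := by
          calc _ = (1 + r * κ / 3) * (l ^ 2 / 2) * c ^ 2 := by ring
            _ ≤ _ := mul_le_mul_of_nonneg_left h6 (by positivity)
        calc p * (Real.exp (l * c) - 1)
            ≤ p * (l * c + (1 + r * κ / 3) * (l ^ 2 / 2) * (c * κ)) :=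
              mul_le_mul_of_nonneg_left (by linarith) hp0.le
          _ = (l + l ^ 2 * κ / 2 * (1 + r * κ / 3)) * (p * c) := by ring
          _ = _ := by rw [hpy]
      have hsum := Finset.sum_le_sum (fun i (_ : i ∈ Finset.univ) => hi i)
      rw [← Finset.mul_sum Finset.univ y, hy1, mul_one] at hsum
      have key : L + l ^ 2 * κ / 2 * (1 + r * κ / 3) ≤ l * α := by
        refine le_of_mul_le_mul_right ?_ hq
        calc (L + l ^ 2 * κ / 2 * (1 + r * κ / 3)) * (1 + r * κ / 3)
            = L * (1 + r * κ / 3) + (l * (1 + r * κ / 3)) ^ 2 * κ / 2 := by ring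
          _ = L * (1 + r * κ / 3) + L := by rw [hlq, hr2]; ring
          _ ≤ r * α := by
            rw [hrα]
            have : 0 ≤ r * κ * L := by positivity
            linarith
          _ = (l * (1 + r * κ / 3)) * α := by rw [hlq]
          _ = _ := by ring
      linarith
  have hlo : ∑ ω ∈ Finset.univ.filter (fun ω : Fin n → Bool =>
      ∑ i ∈ Finset.univ.filter (fun i => ω i = true), y i / p ≤ 1 - α),
      (∏ i, (if ω i then p else 1 - p)) ≤ Real.exp (-L) := by
    refine bne_chernoff p hp0.le hp1 (fun i => -r * (y i / p)) (-r * (1 - α)) L _ ?_ ?_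
    · intro ω h
      rw [← Finset.mul_sum]
      have := mul_le_mul_of_nonneg_left h hr0.le
      linarith
    · have hi : ∀ i, p * (Real.exp (-r * (y i / p)) - 1) ≤
          (-r + r ^ 2 * κ / 2) * y i := by
        intro i
        have hc0 : 0 ≤ y i / p := div_nonneg (hy0 i) hp0.le
        have hc1 := hyκ i
        have hpy : p * (y i / p) = y i := by field_simp
        generalize y i / p = c at *
        have hu : 0 ≤ r * c := by positivity
        have h1 := bne_exp_neg hu
        rw [← neg_mul] at h1
        have h6 : c ^ 2 ≤ c * κ := by nlinarith
        have h7 : (r * c) ^ 2 / 2 ≤ r ^ 2 / 2 * (c * κ) := by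
          calc _ = r ^ 2 / 2 * c ^ 2 := by ring
            _ ≤ _ := mul_le_mul_of_nonneg_left h6 (by positivity)
        calc p * (Real.exp (-r * c) - 1)
            ≤ p * (-r * c + r ^ 2 / 2 * (c * κ)) :=
              mul_le_mul_of_nonneg_left (by linarith) hp0.le
          _ = (-r + r ^ 2 * κ / 2) * (p * c) := by ring
          _ = _ := by rw [hpy]
      have hsum := Finset.sum_le_sum (fun i (_ : i ∈ Finset.univ) => hi i)
      rw [← Finset.mul_sum Finset.univ y, hy1, mul_one, hr2] at hsum
      have : 0 ≤ r * κ * (2 * L / 3) := by positivity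
      linarith
  have hsplit := Finset.sum_filter_add_sum_filter_not Finset.univ P
    (fun ω : Fin n → Bool => ∏ i, (if ω i then p else 1 - p))
  rw [htot] at hsplit
  have hbad : ∑ ω ∈ Finset.univ.filter (fun ω => ¬ P ω), (∏ i, (if ω i then p else 1 - p)) ≤
      Real.exp (-L) + Real.exp (-L) := by
    refine le_trans ?_ (add_le_add hup hlo)
    rw [Finset.sum_filter, Finset.sum_filter, Finset.sum_filter, ← Finset.sum_add_distrib]
    refine Finset.sum_le_sum fun ω _ => ?_
    have h0 := hw ω
    by_cases h : P ω
    · simp only [h, not_true_eq_false, if_false]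
      split_ifs <;> linarith
    · rcases hP ω h with h1 | h1
      · simp only [h, not_false_eq_true, if_true, h1]
        split_ifs <;> linarith
      · simp only [h, not_false_eq_true, if_true, h1]
        split_ifs <;> linarith
  linarith

/-- Bernoulli subsampling of the entries of an incoherent vector yields a
multiplicative estimate of its squared norm with probability at least `1 - 2δ`. -/
theorem bernoulli_norm_estimation
    {n : ℕ} (x : EuclideanSpace ℝ (Fin n)) (hx : x ≠ 0)
    (μ0 : ℝ) (hμ : muVec x ≤ μ0)
    (δ : ℝ) (hδ0 : 0 < δ) (hδ1 : δ < 1)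
    (m : ℝ) (hm0 : 0 < m) (hmn : m ≤ n) :
    1 - 2 * δ ≤
      ∑ ω ∈ Finset.univ.filter (fun ω : Fin n → Bool =>
          (1 - (Real.sqrt (2 * μ0 * Real.log (1 / δ) / m) +
              2 * μ0 / (3 * m) * Real.log (1 / δ))) * ‖x‖^2 ≤
            (n : ℝ) / m * ∑ i ∈ Finset.univ.filter (fun i => ω i = true), (x i)^2 ∧
          (n : ℝ) / m * ∑ i ∈ Finset.univ.filter (fun i => ω i = true), (x i)^2 ≤
            (1 + (Real.sqrt (2 * μ0 * Real.log (1 / δ) / m) +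
              2 * μ0 / (3 * m) * Real.log (1 / δ))) * ‖x‖^2),
        ∏ i : Fin n, (if ω i then m / n else 1 - m / n) := by
  have hn : 0 < (n : ℝ) := lt_of_lt_of_le hm0 hmn
  have hS : 0 < ‖x‖ ^ 2 := by
    have := norm_pos_iff.2 hx
    positivity
  have hSsum : ‖x‖ ^ 2 = ∑ i, (x i) ^ 2 := EuclideanSpace.real_norm_sq_eq x
  have hL : 0 < Real.log (1 / δ) := Real.log_pos (by rw [lt_div_iff₀ hδ0]; linarith)
  have hexp : Real.exp (-Real.log (1 / δ)) = δ := by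
    rw [one_div, Real.log_inv, neg_neg, Real.exp_log hδ0]
  have hmu : ∀ i, (n : ℝ) * (x i) ^ 2 ≤ μ0 * ‖x‖ ^ 2 := by
    intro i
    have h1 : |x i| ≤ ⨆ i, |x i| := le_ciSup (f := fun i => |x i|) (Set.finite_range _).bddAbove i
    have h2 : (x i) ^ 2 ≤ (⨆ i, |x i|) ^ 2 := by
      rw [← sq_abs]
      exact pow_le_pow_left₀ (abs_nonneg _) h1 2
    unfold muVec at hμ
    rw [div_le_iff₀ hS] at hμ
    exact le_trans (mul_le_mul_of_nonneg_left h2 hn.le) hμ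
  have hμ0 : 0 < μ0 := by
    by_contra h
    push Not at h
    have h1 : ∀ i, (x i) ^ 2 ≤ 0 := fun i => by
      have h2 := hmu i
      have h3 : μ0 * ‖x‖ ^ 2 ≤ 0 := mul_nonpos_of_nonpos_of_nonneg h hS.le
      by_contra h4
      push Not at h4
      have := mul_pos hn h4
      linarith
    have := Finset.sum_nonpos (fun i (_ : i ∈ Finset.univ) => h1 i)
    linarith
  have hsc : ∀ ω : Fin n → Bool,
      ∑ i ∈ Finset.univ.filter (fun i => ω i = true), (x i) ^ 2 / ‖x‖ ^ 2 / (m / n) =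
      ((n : ℝ) / m * ∑ i ∈ Finset.univ.filter (fun i => ω i = true), (x i) ^ 2) / ‖x‖ ^ 2 := by
    intro ω
    rw [Finset.mul_sum, Finset.sum_div]
    refine Finset.sum_congr rfl fun i _ => ?_
    field_simp
  have hfin := bne_core (m / n) (by positivity) ((div_le_one hn).2 hmn)
    (fun i => (x i) ^ 2 / ‖x‖ ^ 2) (fun i => by positivity)
    (by rw [← Finset.sum_div, ← hSsum, div_self hS.ne']) (μ0 / m) (Real.log (1 / δ))
    (by positivity) hL
    (fun i => by
      have := hmu i
      rw [div_div_eq_mul_div, div_le_div_iff_of_pos_right hm0, div_mul_eq_mul_div,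
        div_le_iff₀ hS]
      linarith)
    (Real.sqrt (2 * μ0 * Real.log (1 / δ) / m) + 2 * μ0 / (3 * m) * Real.log (1 / δ))
    (by
      congr 1
      · congr 1; ring
      · field_simp)
    (fun ω : Fin n → Bool =>
          (1 - (Real.sqrt (2 * μ0 * Real.log (1 / δ) / m) +
              2 * μ0 / (3 * m) * Real.log (1 / δ))) * ‖x‖^2 ≤
            (n : ℝ) / m * ∑ i ∈ Finset.univ.filter (fun i => ω i = true), (x i)^2 ∧
          (n : ℝ) / m * ∑ i ∈ Finset.univ.filter (fun i => ω i = true), (x i)^2 ≤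
            (1 + (Real.sqrt (2 * μ0 * Real.log (1 / δ) / m) +
              2 * μ0 / (3 * m) * Real.log (1 / δ))) * ‖x‖^2)
    (by
      intro ω h
      simp only [hsc]
      rw [le_div_iff₀ hS, div_le_iff₀ hS]
      by_contra h2
      push Not at h2
      exact h ⟨h2.2.le, h2.1.le⟩)
  rw [hexp] at hfin
  exact hfin
end
end
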